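/- Let Σ = diag(σ₁²,...,σ_m²) with all σ_i > 0, ε₀ ~ N(0, Σ) on ℝᵐ, and let q(y|x;ε) = E_ε[p(y|φ(x,ε))] with p ∈ [0,1]. If q(y_A|x;ε₀) ≥ p_A > p_B ≥ max_{y≠y_A} q(y|x;ε₀) and √(Σᵢ (αᵢ/σᵢ)²) < ½(Φ⁻¹(p_A) - Φ⁻¹(p_B)), then q(y_A|x; α+ε₀) > max_{y≠y_A} q(y|x; α+ε₀). -/

import Mathlib

open MeasureTheory ProbabilityTheory

lemma aux_gauss_shift (a s : ℝ) (hs : 0 < s) :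
    (gaussianReal 0 (Real.toNNReal (s ^ 2))).map (a + ·) =
      (gaussianReal 0 (Real.toNNReal (s ^ 2))).withDensity
        (fun x => ENNReal.ofReal (Real.exp (a / s ^ 2 * x - (a / s) ^ 2 / 2))) := by
  have hv : Real.toNNReal (s ^ 2) ≠ 0 := by
    have : 0 < s ^ 2 := by positivity
    simpa using hs.ne'
  have hc : ((Real.toNNReal (s ^ 2) : NNReal) : ℝ) = s ^ 2 :=
    Real.coe_toNNReal _ (by positivity)
  rw [gaussianReal_map_const_add, gaussianReal_of_var_ne_zero _ hv,
    gaussianReal_of_var_ne_zero _ hv, ← withDensity_mul _ (measurable_gaussianPDF _ _) (by fun_prop)]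
  congr 1
  ext x
  simp only [Pi.mul_apply, gaussianPDF]
  rw [← ENNReal.ofReal_mul (gaussianPDFReal_nonneg _ _ _)]
  congr 1
  simp only [gaussianPDFReal, hc]
  rw [mul_assoc (√(2 * Real.pi * s ^ 2))⁻¹, ← Real.exp_add]
  congr 2
  field_simp
  ring

lemma aux_pi_shift {m : ℕ} (σ : Fin m → ℝ) (hσ : ∀ i, 0 < σ i) (α : Fin m → ℝ) :
    (Measure.pi fun i => gaussianReal 0 (Real.toNNReal (σ i ^ 2))).map (α + ·) =
      (Measure.pi fun i => gaussianReal 0 (Real.toNNReal (σ i ^ 2))).withDensity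
        (fun x => ∏ i, ENNReal.ofReal (Real.exp (α i / σ i ^ 2 * x i - (α i / σ i) ^ 2 / 2))) := by
  have h1 : (Measure.pi fun i => gaussianReal 0 (Real.toNNReal (σ i ^ 2))).map (α + ·) =
      Measure.pi fun i => (gaussianReal 0 (Real.toNNReal (σ i ^ 2))).map (α i + ·) := by
    have := Measure.pi_map_pi (μ := fun i => gaussianReal 0 (Real.toNNReal (σ i ^ 2)))
      (f := fun i x => α i + x) (fun i => by fun_prop)
    exact this
  have hp : ∀ i, IsProbabilityMeasure
      ((gaussianReal 0 (Real.toNNReal (σ i ^ 2))).map (α i + ·)) := fun i =>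
    Measure.isProbabilityMeasure_map (by fun_prop)
  rw [h1]
  refine Measure.pi_eq fun s hs => ?_
  rw [withDensity_apply _ (MeasurableSet.univ_pi hs), ← lintegral_indicator (MeasurableSet.univ_pi hs)]
  let X : Fin m → ℝ → ENNReal := fun i => (s i).indicator
    (fun x => ENNReal.ofReal (Real.exp (α i / σ i ^ 2 * x - (α i / σ i) ^ 2 / 2)))
  have hX : ∀ i, Measurable (X i) := fun i => Measurable.indicator (by fun_prop) (hs i)
  have h2 : ∀ x : Fin m → ℝ, (Set.univ.pi s).indicator
      (fun x => ∏ i, ENNReal.ofReal (Real.exp (α i / σ i ^ 2 * x i - (α i / σ i) ^ 2 / 2))) x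
      = ∏ i, X i (x i) := by
    intro x
    by_cases hx : x ∈ Set.univ.pi s
    · rw [Set.indicator_of_mem hx]
      refine Finset.prod_congr rfl fun i _ => ?_
      simp only [X]
      rw [Set.indicator_of_mem (hx i (Set.mem_univ i))]
    · rw [Set.indicator_of_notMem hx]
      simp only [Set.mem_pi, Set.mem_univ, true_imp_iff, not_forall] at hx
      obtain ⟨i, hi⟩ := hx
      refine (Finset.prod_eq_zero (Finset.mem_univ i) ?_).symm
      simp only [X]
      rw [Set.indicator_of_notMem hi]
  simp_rw [h2]
  rw [lintegral_prod_eq_prod_lintegral_of_indepFun Finset.univ (fun i (x : Fin m → ℝ) => X i (x i))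
    (iIndepFun_pi fun i => (hX i).aemeasurable) (fun i => (hX i).comp (measurable_pi_apply i))]
  refine Finset.prod_congr rfl fun i _ => ?_
  rw [aux_gauss_shift _ _ (hσ i), withDensity_apply _ (hs i), ← lintegral_indicator (hs i)]
  exact (measurePreserving_eval (fun i => gaussianReal 0 (Real.toNNReal (σ i ^ 2))) i).lintegral_comp
    (hX i)

lemma aux_integral_shift {m : ℕ} (σ : Fin m → ℝ) (hσ : ∀ i, 0 < σ i) (α : Fin m → ℝ)
    (g : (Fin m → ℝ) → ℝ) (hg : Measurable g) :
    ∫ x, g (α + x) ∂(Measure.pi fun i => gaussianReal 0 (Real.toNNReal (σ i ^ 2))) =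
      ∫ x, Real.exp (∑ i, α i / σ i ^ 2 * x i - (∑ i, (α i / σ i) ^ 2) / 2) * g x
        ∂(Measure.pi fun i => gaussianReal 0 (Real.toNNReal (σ i ^ 2))) := by
  rw [← integral_map (φ := (α + ·)) (by fun_prop) hg.aestronglyMeasurable, aux_pi_shift σ hσ α,
    integral_withDensity_eq_integral_toReal_smul (by fun_prop)
      (ae_of_all _ fun x => ENNReal.prod_lt_top (by simp))]
  congr 1
  ext x
  rw [ENNReal.toReal_prod, smul_eq_mul]
  congr 1
  simp_rw [ENNReal.toReal_ofReal (Real.exp_pos _).le]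
  rw [← Real.exp_sum, Finset.sum_sub_distrib, Finset.sum_div]

lemma aux_integrable_shift {m : ℕ} (σ : Fin m → ℝ) (hσ : ∀ i, 0 < σ i) (α : Fin m → ℝ)
    (g : (Fin m → ℝ) → ℝ) (hg : Measurable g) (hr : ∀ x, g x ∈ Set.Icc (0 : ℝ) 1) :
    Integrable (fun x => Real.exp (∑ i, α i / σ i ^ 2 * x i - (∑ i, (α i / σ i) ^ 2) / 2) * g x)
        (Measure.pi fun i => gaussianReal 0 (Real.toNNReal (σ i ^ 2))) := by
  have h1 : Integrable
      (fun x => Real.exp (∑ i, α i / σ i ^ 2 * x i - (∑ i, (α i / σ i) ^ 2) / 2))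
      (Measure.pi fun i => gaussianReal 0 (Real.toNNReal (σ i ^ 2))) := by
    by_contra h
    have := aux_integral_shift σ hσ α (fun _ => 1) measurable_const
    simp only [mul_one] at this
    rw [integral_undef h] at this
    simp at this
  refine h1.mono (by fun_prop) (ae_of_all _ fun x => ?_)
  rw [norm_mul]
  refine mul_le_of_le_one_right (norm_nonneg _) ?_
  rw [Real.norm_eq_abs, abs_le]
  constructor <;> linarith [(hr x).1, (hr x).2]

lemma aux_law {m : ℕ} (σ : Fin m → ℝ) (hσ : ∀ i, 0 < σ i) (α : Fin m → ℝ) :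
    (Measure.pi fun i => gaussianReal 0 (Real.toNNReal (σ i ^ 2))).map
      (fun x => ∑ i, α i / σ i ^ 2 * x i) =
      gaussianReal 0 (Real.toNNReal (∑ i, (α i / σ i) ^ 2)) := by
  have hG : HasGaussianLaw (fun x : Fin m → ℝ => ∑ i, α i / σ i ^ 2 * x i)
      (Measure.pi fun i => gaussianReal 0 (Real.toNNReal (σ i ^ 2))) := by
    refine iIndepFun.hasGaussianLaw_fun_sum (X := fun i (x : Fin m → ℝ) => α i / σ i ^ 2 * x i)
      (fun i => ⟨?_⟩)
      (iIndepFun_pi (X := fun i (x : ℝ) => α i / σ i ^ 2 * x) fun i => by fun_prop)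
    have : (fun x : Fin m → ℝ => α i / σ i ^ 2 * x i) =
      (α i / σ i ^ 2 * ·) ∘ (Function.eval i) := rfl
    rw [this, ← Measure.map_map (by fun_prop) (by fun_prop),
      (measurePreserving_eval (fun i => gaussianReal 0 (Real.toNNReal (σ i ^ 2))) i).map_eq,
      gaussianReal_map_const_mul]
    infer_instance
  rw [hG.map_eq_gaussianReal]
  congr 1
  · rw [integral_finsetSum]
    · refine Finset.sum_eq_zero fun i _ => ?_
      rw [integral_const_mul]
      have := integral_comp_eval (μ := fun i => gaussianReal 0 (Real.toNNReal (σ i ^ 2))) (i := i)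
        (f := fun x : ℝ => x) (by fun_prop)
      rw [this]
      simp
    · intro i _
      exact (integrable_eval IsGaussian.integrable_id).const_mul _
  · congr 1
    have : (fun x : Fin m → ℝ => ∑ i, α i / σ i ^ 2 * x i) =
      ∑ i, (fun x : Fin m → ℝ => α i / σ i ^ 2 * x i) := by ext x; simp
    rw [this, variance_sum_pi (X := fun i (x : ℝ) => α i / σ i ^ 2 * x)
      (fun i => IsGaussian.memLp_two_id.const_mul _)]
    refine Finset.sum_congr rfl fun i _ => ?_
    change Var[fun x ↦ _ * (id x); _] = _
    rw [variance_const_mul, variance_id_gaussianReal, Real.coe_toNNReal _ (by positivity)]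
    have := (hσ i).ne'
    field_simp

lemma aux_half {m : ℕ} (σ : Fin m → ℝ) (hσ : ∀ i, 0 < σ i) (α : Fin m → ℝ)
    (hs : 0 < Real.sqrt (∑ i, (α i / σ i) ^ 2)) (t : ℝ) :
    (Measure.pi fun i => gaussianReal 0 (Real.toNNReal (σ i ^ 2))).real
      {x | ∑ i, α i / σ i ^ 2 * x i ≤ Real.sqrt (∑ i, (α i / σ i) ^ 2) * t} =
      cdf (gaussianReal 0 1) t := by
  set s := Real.sqrt (∑ i, (α i / σ i) ^ 2) with hsdef
  have hss : ∑ i, (α i / σ i) ^ 2 = s ^ 2 :=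
    (Real.sq_sqrt (Finset.sum_nonneg fun i _ => sq_nonneg _)).symm
  have h1 : gaussianReal 0 (Real.toNNReal (s ^ 2)) = (gaussianReal 0 1).map (s * ·) := by
    rw [gaussianReal_map_const_mul, mul_zero, mul_one]
    congr 1
    ext
    simp [sq_nonneg]
  have h2 : (Measure.pi fun i => gaussianReal 0 (Real.toNNReal (σ i ^ 2)))
      {x | ∑ i, α i / σ i ^ 2 * x i ≤ s * t} = gaussianReal 0 1 (Set.Iic t) := by
    have := aux_law σ hσ α
    rw [hss, h1] at this
    have h3 := congrArg (fun ν => ν (Set.Iic (s * t))) this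
    beta_reduce at h3
    rw [Measure.map_apply (by fun_prop) measurableSet_Iic,
      Measure.map_apply (by fun_prop) measurableSet_Iic] at h3
    have h4 : (fun x => s * x) ⁻¹' Set.Iic (s * t) = Set.Iic t := by
      ext x
      exact mul_le_mul_iff_right₀ hs
    rw [h4] at h3
    exact h3
  rw [cdf_eq_real, measureReal_def, measureReal_def, h2]

lemma aux_int {m : ℕ} (ν : Measure (Fin m → ℝ)) [IsProbabilityMeasure ν]
    (g : (Fin m → ℝ) → ℝ) (hg : Measurable g) (hr : ∀ x, g x ∈ Set.Icc (0 : ℝ) 1) :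
    Integrable g ν := by
  refine Integrable.of_bound hg.aestronglyMeasurable 1 (ae_of_all _ fun x => ?_)
  rw [Real.norm_eq_abs, abs_le]
  constructor <;> linarith [(hr x).1, (hr x).2]

/-- Neyman–Pearson bound. -/
lemma aux_np {m : ℕ} (σ : Fin m → ℝ) (hσ : ∀ i, 0 < σ i) (α : Fin m → ℝ)
    (g : (Fin m → ℝ) → ℝ) (hg : Measurable g) (hr : ∀ x, g x ∈ Set.Icc (0 : ℝ) 1) (t : ℝ)
    (h : cdf (gaussianReal 0 1) t ≤
      ∫ x, g x ∂(Measure.pi fun i => gaussianReal 0 (Real.toNNReal (σ i ^ 2)))) :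
    cdf (gaussianReal 0 1) (t - Real.sqrt (∑ i, (α i / σ i) ^ 2)) ≤
      ∫ x, g (α + x) ∂(Measure.pi fun i => gaussianReal 0 (Real.toNNReal (σ i ^ 2))) := by
  have hnn : 0 ≤ ∑ i, (α i / σ i) ^ 2 := Finset.sum_nonneg fun i _ => sq_nonneg _
  rcases (Real.sqrt_nonneg (∑ i, (α i / σ i) ^ 2)).eq_or_lt with h0 | hs
  · have h1 : ∑ i, (α i / σ i) ^ 2 = 0 := (Real.sqrt_eq_zero hnn).1 h0.symm
    have h2 : α = 0 := by
      ext i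
      have := (Finset.sum_eq_zero_iff_of_nonneg fun i _ => sq_nonneg (α i / σ i)).1 h1 i
        (Finset.mem_univ i)
      have h3 := (hσ i).ne'
      simpa [h3] using this
    rw [← h0, sub_zero, h2]
    simpa using h
  · have hhalf := aux_half σ hσ α hs
    have hsh := aux_integral_shift σ hσ α
    have hish := aux_integrable_shift σ hσ α
    set s := Real.sqrt (∑ i, (α i / σ i) ^ 2) with hsdef
    have hss : ∑ i, (α i / σ i) ^ 2 = s ^ 2 := (Real.sq_sqrt hnn).symm
    set ν := Measure.pi fun i => gaussianReal 0 (Real.toNNReal (σ i ^ 2)) with hν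
    set H : Set (Fin m → ℝ) := {x | ∑ i, α i / σ i ^ 2 * x i ≤ s * t} with hH
    have hHm : MeasurableSet H := measurableSet_le (by fun_prop) (by fun_prop)
    let k : (Fin m → ℝ) → ℝ := H.indicator (fun _ => 1)
    have hk : Measurable k := measurable_const.indicator hHm
    have hkr : ∀ x, k x ∈ Set.Icc (0 : ℝ) 1 := by
      intro x
      by_cases hx : x ∈ H <;> simp [k, hx]
    have hk1 : ∫ x, k x ∂ν = cdf (gaussianReal 0 1) t := by
      rw [← hhalf t]
      simp only [k]
      rw [integral_indicator_const _ hHm, smul_eq_mul, mul_one]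
    have hk2 : ∫ x, k (α + x) ∂ν = cdf (gaussianReal 0 1) (t - s) := by
      rw [← hhalf (t - s)]
      have : (fun x => k (α + x)) = ({x | ∑ i, α i / σ i ^ 2 * x i ≤ s * (t - s)} :
          Set (Fin m → ℝ)).indicator (fun _ => (1 : ℝ)) := by
        ext x
        have he : α + x ∈ H ↔ x ∈ {x : Fin m → ℝ | ∑ i, α i / σ i ^ 2 * x i ≤ s * (t - s)} := by
          simp only [hH, Set.mem_ofPred_eq, Pi.add_apply, mul_add, Finset.sum_add_distrib]
          have : ∑ i, α i / σ i ^ 2 * α i = s ^ 2 := by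
            rw [← hss]
            refine Finset.sum_congr rfl fun i _ => ?_
            have := (hσ i).ne'
            field_simp
          rw [this]
          constructor <;> intro h <;> nlinarith
        simp only [k, Set.indicator_apply, he]
      rw [this, integral_indicator_const _ (measurableSet_le (by fun_prop) (by fun_prop))]; simp
    rw [← hk2, hsh k hk, hsh g hg]
    rw [← sub_nonneg, ← integral_sub (hish g hg hr) (hish k hk hkr)]
    have hgi := aux_int ν g hg hr
    have hki := aux_int ν k hk hkr
    have h5 : 0 ≤ ∫ x, Real.exp (s * t - (∑ i, (α i / σ i) ^ 2) / 2) * (g x - k x) ∂ν := by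
      rw [integral_const_mul, integral_sub hgi hki, hk1]
      exact mul_nonneg (Real.exp_pos _).le (by linarith)
    refine h5.trans (integral_mono ((hgi.sub hki).const_mul _)
      ((hish g hg hr).sub (hish k hk hkr)) fun x => ?_)
    simp only
    rw [← mul_sub]
    by_cases hx : x ∈ H
    · have hkx : k x = 1 := by simp [k, hx]
      have hx' : ∑ i, α i / σ i ^ 2 * x i ≤ s * t := hx
      refine mul_le_mul_of_nonpos_right (Real.exp_le_exp.2 (by linarith)) ?_
      rw [hkx]; linarith [(hr x).2]
    · have hkx : k x = 0 := by simp [k, hx]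
      have hx' : s * t < ∑ i, α i / σ i ^ 2 * x i := not_le.1 hx
      refine mul_le_mul_of_nonneg_right (Real.exp_le_exp.2 (by linarith)) ?_
      rw [hkx]; linarith [(hr x).1]

lemma aux_zero_iff {m : ℕ} (σ : Fin m → ℝ) (hσ : ∀ i, 0 < σ i) (α : Fin m → ℝ)
    (g : (Fin m → ℝ) → ℝ) (hg : Measurable g) (hr : ∀ x, g x ∈ Set.Icc (0 : ℝ) 1) :
    ∫ x, g (α + x) ∂(Measure.pi fun i => gaussianReal 0 (Real.toNNReal (σ i ^ 2))) = 0 ↔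
      ∫ x, g x ∂(Measure.pi fun i => gaussianReal 0 (Real.toNNReal (σ i ^ 2))) = 0 := by
  rw [aux_integral_shift σ hσ α g hg,
    integral_eq_zero_iff_of_nonneg (fun x => mul_nonneg (Real.exp_pos _).le (hr x).1)
      (aux_integrable_shift σ hσ α g hg hr),
    integral_eq_zero_iff_of_nonneg (fun x => (hr x).1) (aux_int _ g hg hr)]
  refine Filter.eventually_congr (ae_of_all _ fun x => ?_)
  simp [Real.exp_ne_zero]

lemma aux_cdf_strictMono : StrictMono (fun x => cdf (gaussianReal 0 1) x) := by
  intro a b hab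
  have h : 0 < gaussianReal 0 1 (Set.Ioc a b) := by
    rw [pos_iff_ne_zero]
    intro h0
    have := gaussianReal_absolutelyContinuous' 0 one_ne_zero h0
    simp at this
    linarith
  rw [← measure_cdf (gaussianReal 0 1), StieltjesFunction.measure_Ioc] at h
  simpa using h

lemma aux_cdf_neg (t : ℝ) : cdf (gaussianReal 0 1) (-t) = 1 - cdf (gaussianReal 0 1) t := by
  have := nullSingletonClass_gaussianReal (μ := 0) (v := 1) one_ne_zero
  rw [cdf_eq_real, cdf_eq_real, ← probReal_compl_eq_one_sub measurableSet_Iic, Set.compl_Iic,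
    measureReal_def, measureReal_def, measure_congr Ioi_ae_eq_Ici]
  congr 1
  have h : (gaussianReal 0 1).map (fun x ↦ -x) = gaussianReal 0 1 := by
    rw [gaussianReal_map_neg, neg_zero]
  conv_lhs => rw [← h]
  rw [Measure.map_apply (by fun_prop) measurableSet_Iic]
  congr 1
  ext x; simp

lemma aux_cdf_surj (p : ℝ) (h0 : 0 < p) (h1 : p < 1) : ∃ x, cdf (gaussianReal 0 1) x = p := by
  have := nullSingletonClass_gaussianReal (μ := 0) (v := 1) one_ne_zero
  have hc : Continuous (fun x => cdf (gaussianReal 0 1) x) := by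
    rw [continuous_iff_continuousAt]
    intro x
    have h2 : (cdf (gaussianReal 0 1)).measure {x} = 0 := by
      rw [measure_cdf]; exact measure_singleton x
    rw [StieltjesFunction.measure_singleton, ENNReal.ofReal_eq_zero] at h2
    have h3 : Function.leftLim (cdf (gaussianReal 0 1)) x = cdf (gaussianReal 0 1) x :=
      le_antisymm ((cdf (gaussianReal 0 1)).mono.leftLim_le le_rfl) (by linarith)
    rw [continuousAt_iff_continuous_left'_right']
    refine ⟨?_, ?_⟩
    · exact ((cdf (gaussianReal 0 1)).mono.continuousWithinAt_Iio_iff_leftLim_eq).2 h3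
    · exact ((cdf (gaussianReal 0 1)).right_continuous x).mono Set.Ioi_subset_Ici_self
  obtain ⟨a, ha⟩ := ((tendsto_cdf_atBot (gaussianReal 0 1)).eventually_lt_const h0).exists
  obtain ⟨b, hb⟩ := ((tendsto_cdf_atTop (gaussianReal 0 1)).eventually_const_lt h1).exists
  exact mem_range_of_exists_le_of_exists_ge hc ⟨a, ha.le⟩ ⟨b, hb.le⟩

/-- Multivariate anisotropic Gaussian randomized smoothing certification: with
ε₀ ~ N(0, diag(σ₁²,...,σ_m²)), if q(y_A|x;ε₀) ≥ p_A > p_B ≥ max_{y≠y_A} q(y|x;ε₀)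
and √(Σᵢ (αᵢ/σᵢ)²) < ½(Φ⁻¹(p_A) − Φ⁻¹(p_B)), then
q(y_A|x; α+ε₀) > max_{y≠y_A} q(y|x; α+ε₀). -/
theorem stmt_13 {Y : Type*} (m : ℕ) (f : Y → (Fin m → ℝ) → ℝ)
    (hmeas : ∀ y, Measurable (f y))
    (hrange : ∀ y ε, f y ε ∈ Set.Icc (0 : ℝ) 1)
    (σ : Fin m → ℝ) (hσ : ∀ i, 0 < σ i)
    (μ : Measure (Fin m → ℝ))
    (hμ : μ = Measure.pi fun i => gaussianReal 0 (Real.toNNReal (σ i ^ 2)))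
    (Φ : ℝ → ℝ) (hΦ : Φ = fun x => cdf (gaussianReal 0 1) x)
    (Φinv : ℝ → ℝ) (hΦinv : Φinv = Function.invFun Φ)
    (yA : Y) (pA pB : ℝ)
    (hA : pA ≤ ∫ ε, f yA ε ∂μ)
    (hAB : pB < pA)
    (hB : ∀ y, y ≠ yA → ∫ ε, f y ε ∂μ ≤ pB)
    (α : Fin m → ℝ)
    (hα : Real.sqrt (∑ i, (α i / σ i) ^ 2) < (1 / 2) * (Φinv pA - Φinv pB)) :
    ∀ y, y ≠ yA → ∫ ε, f y (α + ε) ∂μ < ∫ ε, f yA (α + ε) ∂μ := by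
  intro y hy
  have h0 : ∀ y, 0 ≤ ∫ ε, f y ε ∂μ := fun y => integral_nonneg fun x => (hrange y x).1
  have h0' : ∀ y, 0 ≤ ∫ ε, f y (α + ε) ∂μ := fun y => integral_nonneg fun x => (hrange y _).1
  have hp : IsProbabilityMeasure μ := by rw [hμ]; infer_instance
  have hm' : ∀ y, Measurable fun x => 1 - f y x := fun y => measurable_const.sub (hmeas y)
  have hr' : ∀ y x, 1 - f y x ∈ Set.Icc (0 : ℝ) 1 := fun y x =>
    ⟨by linarith [(hrange y x).2], by linarith [(hrange y x).1]⟩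
  have hc : ∀ y, ∫ ε, (1 - f y ε) ∂μ = 1 - ∫ ε, f y ε ∂μ := fun y => by
    rw [integral_sub (integrable_const _) (aux_int μ _ (hmeas y) (hrange y))]; simp
  have hc' : ∀ y, ∫ ε, (1 - f y (α + ε)) ∂μ = 1 - ∫ ε, f y (α + ε) ∂μ := fun y => by
    rw [integral_sub (integrable_const _) (aux_int μ (fun x => f y (α + x)) ((hmeas y).comp (by fun_prop))
      (fun x => hrange y _))]; simp
  have h1 : ∀ y, ∫ ε, f y ε ∂μ ≤ 1 := fun y => by
    have : 0 ≤ ∫ ε, (1 - f y ε) ∂μ := integral_nonneg fun x => (hr' y x).1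
    linarith [hc y]
  have h1' : ∀ y, ∫ ε, f y (α + ε) ∂μ ≤ 1 := fun y => by
    have : 0 ≤ ∫ ε, (1 - f y (α + ε)) ∂μ := integral_nonneg fun x => (hr' y _).1
    linarith [hc' y]
  have hz : ∀ y, ∫ ε, f y (α + ε) ∂μ = 0 ↔ ∫ ε, f y ε ∂μ = 0 := fun y => by
    rw [hμ]; exact aux_zero_iff σ hσ α _ (hmeas y) (hrange y)
  have hz' : ∀ y, ∫ ε, (1 - f y (α + ε)) ∂μ = 0 ↔ ∫ ε, (1 - f y ε) ∂μ = 0 := fun y => by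
    rw [hμ]; exact aux_zero_iff σ hσ α _ (hm' y) (hr' y)
  have hBy := hB y hy
  rcases ((h0 y).trans hBy).eq_or_lt with hB0 | hB0
  · have e1 : ∫ ε, f y (α + ε) ∂μ = 0 := (hz y).2 (le_antisymm (by linarith) (h0 y))
    rw [e1]
    refine lt_of_le_of_ne (h0' yA) fun e => ?_
    have := (hz yA).1 e.symm
    linarith
  rcases (hA.trans (h1 yA)).eq_or_lt with hA1 | hA1
  · have e1 : ∫ ε, f yA (α + ε) ∂μ = 1 := by
      have := (hz' yA).2 (by rw [hc]; linarith [h1 yA])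
      linarith [hc' yA]
    rw [e1]
    refine lt_of_le_of_ne (h1' y) fun e => ?_
    have := (hz' y).1 (by rw [hc', e]; ring)
    linarith [hc y]
  have hinv : ∀ p, 0 < p → p < 1 → cdf (gaussianReal 0 1) (Φinv p) = p := by
    intro p hp0 hp1
    have := Function.invFun_eq (f := Φ) (b := p) (by rw [hΦ]; exact aux_cdf_surj p hp0 hp1)
    rw [← hΦinv] at this
    rwa [hΦ] at this
  have eA := hinv pA (hB0.trans hAB) hA1
  have eB := hinv pB hB0 (hAB.trans hA1)
  have nA := aux_np σ hσ α (f yA) (hmeas yA) (hrange yA) (Φinv pA) (by rw [eA, ← hμ]; exact hA)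
  have nB := aux_np σ hσ α (fun x => 1 - f y x) (hm' y) (hr' y) (-Φinv pB)
    (by rw [aux_cdf_neg, eB, ← hμ, hc]; linarith)
  rw [← hμ] at nA nB
  rw [hc' y, show -Φinv pB - Real.sqrt (∑ i, (α i / σ i) ^ 2) =
    -(Φinv pB + Real.sqrt (∑ i, (α i / σ i) ^ 2)) by ring, aux_cdf_neg] at nB
  have := aux_cdf_strictMono (show Φinv pB + Real.sqrt (∑ i, (α i / σ i) ^ 2) <
    Φinv pA - Real.sqrt (∑ i, (α i / σ i) ^ 2) by linarith)
  simp only at this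
  linarith
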